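/- arXiv:math/0408034 — 3 statements merged into one kernel-verified Lean document; each statement's English description precedes it below -/
import Mathlib

section
/- For every element x ∈ A, the commutator of the Dirac operator D with x is bounded: x maps the span of the basis vectors to itself, and there exists a constant C ≥ 0 such that ‖D x v − x D v‖ ≤ C ‖v‖ for all vectors v in the span of the basis; hence D x − x D extends to a bounded operator on H, denoted [D, x]. -/
noncomputable section

open scoped ComplexConjugate ENNReal InnerProductSpace

/-- Validity predicate for basis indices: the pair `(L, M)` of integers encodes the pair of
half-integers `(l, m) = (L/2, M/2)` with `l ∈ {1/2, 3/2, …}` and `m ∈ {-l, …, l}`. -/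
def IdxP (p : ℤ × ℤ) : Prop := 0 < p.1 ∧ Odd p.1 ∧ Odd p.2 ∧ |p.2| ≤ p.1

instance (p : ℤ × ℤ) : Decidable (IdxP p) := Classical.dec _

/-- The index set of the orthonormal basis `|l,m⟩`; `(L, M)` encodes `l = L/2`, `m = M/2`. -/
abbrev Idx : Type := { p : ℤ × ℤ // IdxP p }

/-- The Hilbert space `H = H_h ⊕ H_h`, realized as `ℓ²` over two copies of the index set;
the Boolean `true` marks the `+` copy and `false` the `-` copy. -/
abbrev HH : Type := lp (fun _ : Idx × Bool => ℂ) 2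

/-- The basis vector `|l,m⟩_±` of `H` (`s = true` for `+`, `s = false` for `-`). -/
def bas (p : Idx) (s : Bool) : HH := lp.single 2 (p, s) 1

/-- The sign `ε` attached to a copy of `H_h` inside `H`. -/
def sgn (s : Bool) : ℝ := if s then 1 else -1

/-- The `q`-number `[x] = (q^x - q^{-x})/(q - q⁻¹)`. -/
def qn (q x : ℝ) : ℝ := (q ^ x - q ^ (-x)) / (q - q⁻¹)

/-- Coefficient of `|l, m+1⟩` in `π_ε(a)|l,m⟩`. -/
def aC1 (q ε l m : ℝ) : ℝ :=
  ε * (1 + q ^ 2) * (q ^ (m - 1/2) / (qn q (2*l) * qn q (2*l + 2))) *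
    Real.sqrt (qn q (l + m + 1) * qn q (l - m))

/-- Coefficient of `|l+1, m+1⟩` in `π_ε(a)|l,m⟩`. -/
def aC2 (q l m : ℝ) : ℝ :=
  q ^ (m - l - 1/2) / qn q (2*l + 2) * Real.sqrt (qn q (l + m + 1) * qn q (l + m + 2))

/-- Coefficient of `|l-1, m+1⟩` in `π_ε(a)|l,m⟩` (which enters with a minus sign). -/
def aC3 (q l m : ℝ) : ℝ :=
  q ^ (m + l + 1/2) / qn q (2*l) * Real.sqrt (qn q (l - m) * qn q (l - m - 1))

/-- Coefficient of `|l, m⟩` in `π_ε(b)|l,m⟩`. -/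
def bC1 (q ε l m : ℝ) : ℝ :=
  ε * ((qn q (l - m + 1) * qn q (l + m) - q ^ 2 * (qn q (l - m) * qn q (l + m + 1))) /
    (qn q (2*l) * qn q (2*l + 2)))

/-- Coefficient of `|l+1, m⟩` in `π_ε(b)|l,m⟩` (which enters with a minus sign). -/
def bC2 (q l m : ℝ) : ℝ :=
  q ^ (m + 1) / qn q (2*l + 2) * Real.sqrt (qn q (l - m + 1) * qn q (l + m + 1))

/-- Coefficient of `|l-1, m⟩` in `π_ε(b)|l,m⟩` (which enters with a minus sign). -/
def bC3 (q l m : ℝ) : ℝ :=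
  q ^ (m + 1) / qn q (2*l) * Real.sqrt (qn q (l - m) * qn q (l + m))

/-- The basis vector `|l,m⟩_±` of `H` (with `L = 2l`, `M = 2m`), defined to be `0` when the
index is out of the allowed range. -/
def ket2 (s : Bool) (L M : ℤ) : HH :=
  if h : IdxP (L, M) then lp.single 2 ((⟨(L, M), h⟩ : Idx), s) 1 else 0

/-- The value of `π(a) = π₊(a) ⊕ π₋(a)` on the basis vector `|l,m⟩_±` of `H`. -/
def aVal2 (q : ℝ) (s : Bool) (L M : ℤ) : HH :=
  ((aC1 q (sgn s) (L/2 : ℝ) (M/2 : ℝ) : ℝ) : ℂ) • ket2 s L (M + 2)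
    + ((aC2 q (L/2 : ℝ) (M/2 : ℝ) : ℝ) : ℂ) • ket2 s (L + 2) (M + 2)
    - ((aC3 q (L/2 : ℝ) (M/2 : ℝ) : ℝ) : ℂ) • ket2 s (L - 2) (M + 2)

/-- The value of `π(b) = π₊(b) ⊕ π₋(b)` on the basis vector `|l,m⟩_±` of `H`. -/
def bVal2 (q : ℝ) (s : Bool) (L M : ℤ) : HH :=
  ((bC1 q (sgn s) (L/2 : ℝ) (M/2 : ℝ) : ℝ) : ℂ) • ket2 s L M
    - ((bC2 q (L/2 : ℝ) (M/2 : ℝ) : ℝ) : ℂ) • ket2 s (L + 2) M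
    - ((bC3 q (L/2 : ℝ) (M/2 : ℝ) : ℝ) : ℂ) • ket2 s (L - 2) M

section BoundedCommutator

variable {E : Type*} [NormedAddCommGroup E] [InnerProductSpace ℂ E]

/-- Pythagoras for a finite family of pairwise orthogonal vectors. -/
lemma norm_sq_sum_of_pairwise_inner_eq_zero {ι : Type*} (w : ι → E)
    (hw : Pairwise fun i j => ⟪w i, w j⟫_ℂ = 0) (s : Finset ι) :
    ‖∑ i ∈ s, w i‖ ^ 2 = ∑ i ∈ s, ‖w i‖ ^ 2 := by
  classical
  induction s using Finset.induction_on with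
  | empty => simp
  | insert a s ha ih =>
    rw [Finset.sum_insert ha, Finset.sum_insert ha, ← ih]
    have h : ⟪w a, ∑ i ∈ s, w i⟫_ℂ = 0 := by
      rw [inner_sum]
      exact Finset.sum_eq_zero fun i hi => hw fun h => ha (h ▸ hi)
    have := norm_add_sq_eq_norm_sq_add_norm_sq_of_inner_eq_zero _ _ h
    simpa only [sq] using this

variable [CompleteSpace E]

/-- A bounded family of pairwise orthogonal vectors is the image of the standard basis of `ℓ²`
under a bounded operator. -/
lemma exists_clm_apply_single {ι : Type*} [DecidableEq ι] (w : ι → E)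
    (hw : Pairwise fun i j => ⟪w i, w j⟫_ℂ = 0) (C : ℝ) (hC : ∀ i, ‖w i‖ ≤ C) :
    ∃ T : lp (fun _ : ι => ℂ) 2 →L[ℂ] E, ∀ i, T (lp.single 2 i 1) = w i := by
  classical
  let e : ι → lp (fun _ : ι => ℂ) 2 := fun i => lp.single 2 i 1
  have he : Pairwise fun i j => ⟪e i, e j⟫_ℂ = 0 := fun i j hij => by
    simp [e, lp.inner_single_left, lp.single_apply, hij]
  have hne : ∀ i, ‖e i‖ = 1 := fun i => by
    simp [e, lp.norm_single]
  have hdense : DenseRange (Finsupp.linearCombination ℂ e) := by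
    intro f
    refine mem_closure_of_tendsto (lp.hasSum_single (by simp) f) (.of_forall fun s => ?_)
    have : ∑ i ∈ s, lp.single 2 i (f i) = ∑ i ∈ s, f i • e i :=
      Finset.sum_congr rfl fun i _ => by
        ext j
        simp [e, lp.single_apply, Pi.single_apply]
    rw [this]
    have hmem : ∑ i ∈ s, f i • e i ∈ LinearMap.range (Finsupp.linearCombination ℂ e) := by
      rw [Finsupp.range_linearCombination]
      exact Submodule.sum_mem _ fun i _ => Submodule.smul_mem _ _ (Submodule.subset_span ⟨i, rfl⟩)
    exact hmem
  have hsq : ∀ (u : ι → E) (hu : Pairwise fun i j => ⟪u i, u j⟫_ℂ = 0) (a : ι →₀ ℂ),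
      ‖Finsupp.linearCombination ℂ u a‖ ^ 2 = ∑ i ∈ a.support, ‖a i‖ ^ 2 * ‖u i‖ ^ 2 := by
    intro u hu a
    rw [Finsupp.linearCombination_apply, Finsupp.sum,
      norm_sq_sum_of_pairwise_inner_eq_zero (fun i => a i • u i)]
    · simp [norm_smul, mul_pow]
    · intro i j hij
      simp [hu hij]
  have hsq' : ∀ a : ι →₀ ℂ,
      ‖Finsupp.linearCombination ℂ e a‖ ^ 2 = ∑ i ∈ a.support, ‖a i‖ ^ 2 := by
    intro a
    have := norm_sq_sum_of_pairwise_inner_eq_zero (fun i => a i • e i) (fun i j hij => by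
      simp [he hij]) a.support
    rw [Finsupp.linearCombination_apply, Finsupp.sum, this]
    simp [norm_smul, hne]
  have hbound : ∃ K, ∀ a, ‖Finsupp.linearCombination ℂ w a‖ ≤
      K * ‖Finsupp.linearCombination ℂ e a‖ := by
    refine ⟨|C|, fun a => ?_⟩
    refine (sq_le_sq₀ (norm_nonneg _) (by positivity)).1 ?_
    rw [mul_pow, hsq w hw, hsq', Finset.mul_sum]
    refine Finset.sum_le_sum fun i _ => ?_
    rw [mul_comm]
    gcongr
    exact (hC i).trans (le_abs_self C)
  refine ⟨(Finsupp.linearCombination ℂ w).extendOfNorm (Finsupp.linearCombination ℂ e),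
    fun i => ?_⟩
  simpa [e] using LinearMap.extendOfNorm_eq hdense hbound (Finsupp.single i 1)

/-- The operator `x` and its adjoint preserve the subspace `S`, and the commutator of `D` with `x`
agrees on `S` with a bounded operator. -/
structure HasBoundedCommutator (S : Submodule ℂ E) (D : E →ₗ[ℂ] E) (x : E →L[ℂ] E) : Prop where
  map_mem : ∀ v ∈ S, x v ∈ S
  star_map_mem : ∀ v ∈ S, star x v ∈ S
  exists_commutator : ∃ T : E →L[ℂ] E, ∀ v ∈ S, T v = D (x v) - x (D v)

namespace HasBoundedCommutator

variable {S : Submodule ℂ E} {D : E →ₗ[ℂ] E} {x y : E →L[ℂ] E}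

lemma of_algebraMap (r : ℂ) : HasBoundedCommutator S D (algebraMap ℂ (E →L[ℂ] E) r) where
  map_mem v hv := by
    simpa [Algebra.algebraMap_eq_smul_one] using S.smul_mem r hv
  star_map_mem v hv := by
    simpa [Algebra.algebraMap_eq_smul_one] using S.smul_mem (star r) hv
  exists_commutator := ⟨0, fun v _ => by simp [Algebra.algebraMap_eq_smul_one]⟩

lemma add (hx : HasBoundedCommutator S D x) (hy : HasBoundedCommutator S D y) :
    HasBoundedCommutator S D (x + y) where
  map_mem v hv := S.add_mem (hx.map_mem v hv) (hy.map_mem v hv)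
  star_map_mem v hv := by
    rw [star_add]
    exact S.add_mem (hx.star_map_mem v hv) (hy.star_map_mem v hv)
  exists_commutator := by
    obtain ⟨T, hT⟩ := hx.exists_commutator
    obtain ⟨U, hU⟩ := hy.exists_commutator
    refine ⟨T + U, fun v hv => ?_⟩
    simp only [add_apply, hT v hv, hU v hv, map_add]
    abel

lemma mul (hx : HasBoundedCommutator S D x) (hy : HasBoundedCommutator S D y) :
    HasBoundedCommutator S D (x * y) where
  map_mem v hv := hx.map_mem _ (hy.map_mem v hv)
  star_map_mem v hv := by
    rw [star_mul]
    exact hy.star_map_mem _ (hx.star_map_mem v hv)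
  exists_commutator := by
    obtain ⟨T, hT⟩ := hx.exists_commutator
    obtain ⟨U, hU⟩ := hy.exists_commutator
    refine ⟨T * y + x * U, fun v hv => ?_⟩
    simp [hT _ (hy.map_mem v hv), hU v hv]

lemma star (hS : Dense (S : Set E)) (hD : ∀ v ∈ S, ∀ w ∈ S, ⟪D v, w⟫_ℂ = ⟪v, D w⟫_ℂ)
    (hx : HasBoundedCommutator S D x) : HasBoundedCommutator S D (star x) where
  map_mem := hx.star_map_mem
  star_map_mem := by simpa using hx.map_mem
  exists_commutator := by
    obtain ⟨T, hT⟩ := hx.exists_commutator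
    refine ⟨-Star.star T, fun v hv => hS.eq_of_inner_right ℂ fun w hw => ?_⟩
    simp only [ContinuousLinearMap.star_eq_adjoint, neg_apply, inner_neg_right,
      inner_sub_right, ContinuousLinearMap.adjoint_inner_right, hT w hw, inner_sub_left]
    rw [hD _ (hx.map_mem w hw) v hv, ← hD w hw _ (by
      simpa [ContinuousLinearMap.star_eq_adjoint] using hx.star_map_mem v hv),
      ContinuousLinearMap.adjoint_inner_right]
    ring

lemma of_mem_adjoin (hS : Dense (S : Set E))
    (hD : ∀ v ∈ S, ∀ w ∈ S, ⟪D v, w⟫_ℂ = ⟪v, D w⟫_ℂ) {s : Set (E →L[ℂ] E)}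
    (hs : ∀ x ∈ s, HasBoundedCommutator S D x) (hx : x ∈ StarAlgebra.adjoin ℂ s) :
    HasBoundedCommutator S D x :=
  StarAlgebra.adjoin_induction (p := fun x _ => HasBoundedCommutator S D x) hs of_algebraMap
    (fun _ _ _ _ => add) (fun _ _ _ _ => mul) (fun _ _ => star hS hD) hx

end HasBoundedCommutator

end BoundedCommutator

/-- The span of the basis vectors `|l,m⟩_±`. -/
def basSpan : Submodule ℂ HH := Submodule.span ℂ (Set.range fun y : Idx × Bool => bas y.1 y.2)

lemma bas_mem_basSpan (p : Idx) (s : Bool) : bas p s ∈ basSpan :=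
  Submodule.subset_span ⟨(p, s), rfl⟩

lemma mem_basSpan_of_finite_support {v : HH} (hv : {i | v i ≠ 0}.Finite) : v ∈ basSpan := by
  have : v = ∑ i ∈ hv.toFinset, v i • bas i.1 i.2 := by
    refine (lp.hasSum_single (by simp) v).unique ?_
    have hsum : ∑ i ∈ hv.toFinset, v i • bas i.1 i.2 = ∑ i ∈ hv.toFinset, lp.single 2 i (v i) :=
      Finset.sum_congr rfl fun i _ => by
        ext j
        simp [bas, lp.single_apply, Pi.single_apply]
    rw [hsum]
    refine hasSum_sum_of_ne_finset_zero fun i hi => ?_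
    have : v i = 0 := by simpa using hi
    ext j
    simp [this]
  rw [this]
  exact Submodule.sum_mem _ fun i _ => Submodule.smul_mem _ _ (bas_mem_basSpan _ _)

lemma dense_basSpan : Dense (basSpan : Set HH) := by
  intro f
  refine mem_closure_of_tendsto (lp.hasSum_single (by simp) f) (.of_forall fun s => ?_)
  refine Submodule.sum_mem _ fun i _ => mem_basSpan_of_finite_support ?_
  refine (Set.finite_singleton i).subset fun j hj => ?_
  by_contra hij
  exact hj (by simp [lp.single_apply, show j ≠ i from hij])

lemma ket2_of_idxP {L M : ℤ} (h : IdxP (L, M)) (s : Bool) : ket2 s L M = bas ⟨(L, M), h⟩ s := by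
  simp [ket2, bas, h]

lemma ket2_eq_zero {L M : ℤ} (h : ¬ IdxP (L, M)) (s : Bool) : ket2 s L M = 0 := by
  simp [ket2, h]

lemma ket2_idx (p : Idx) (s : Bool) : ket2 s p.1.1 p.1.2 = bas p s := ket2_of_idxP p.2 s

lemma ket2_mem_basSpan (s : Bool) (L M : ℤ) : ket2 s L M ∈ basSpan := by
  by_cases h : IdxP (L, M)
  · rw [ket2_of_idxP h]
    exact bas_mem_basSpan _ _
  · rw [ket2_eq_zero h]
    exact basSpan.zero_mem

lemma norm_bas (p : Idx) (s : Bool) : ‖bas p s‖ = 1 := by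
  simp [bas, lp.norm_single]

lemma norm_ket2_le (s : Bool) (L M : ℤ) : ‖ket2 s L M‖ ≤ 1 := by
  by_cases h : IdxP (L, M)
  · rw [ket2_of_idxP h, norm_bas]
  · simp [ket2_eq_zero h]

lemma inner_bas_of_ne {p p' : Idx} {s s' : Bool} (h : (p, s) ≠ (p', s')) :
    ⟪bas p s, bas p' s'⟫_ℂ = 0 := by
  simp [bas, lp.inner_single_left, lp.single_apply, h]

lemma inner_ket2_of_ne {s s' : Bool} {L L' M M' : ℤ} (h : (s, L, M) ≠ (s', L', M')) :
    ⟪ket2 s L M, ket2 s' L' M'⟫_ℂ = 0 := by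
  by_cases h1 : IdxP (L, M)
  · by_cases h2 : IdxP (L', M')
    · rw [ket2_of_idxP h1, ket2_of_idxP h2]
      refine inner_bas_of_ne fun h3 => h ?_
      simp only [Prod.mk.injEq, Subtype.mk.injEq] at h3
      simp [h3]
    · simp [ket2_eq_zero h2]
  · simp [ket2_eq_zero h1]

/-- The family of kets shifted by `(j, d)`, with the sign `±` flipped and scaled by bounded
coefficients, is the image of the basis under a bounded operator. -/
lemma exists_clm_shift (j d : ℤ) (c : Idx → Bool → ℂ) (C : ℝ)
    (hC : ∀ p s, ‖c p s • ket2 (!s) (p.1.1 + j) (p.1.2 + d)‖ ≤ C) :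
    ∃ T : HH →L[ℂ] HH, ∀ p s, T (bas p s) = c p s • ket2 (!s) (p.1.1 + j) (p.1.2 + d) := by
  obtain ⟨T, hT⟩ := exists_clm_apply_single
    (fun i : Idx × Bool => c i.1 i.2 • ket2 (!i.2) (i.1.1.1 + j) (i.1.1.2 + d)) (by
      rintro ⟨p, s⟩ ⟨p', s'⟩ hne
      simp only [inner_smul_left, inner_smul_right]
      rw [inner_ket2_of_ne, mul_zero, mul_zero]
      intro h
      simp only [Prod.mk.injEq, add_left_inj, Bool.not_inj_iff] at h
      exact hne (Prod.ext (Subtype.ext (Prod.ext h.2.1 h.2.2)) h.1)) C (fun i => hC i.1 i.2)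
  exact ⟨T, fun p s => hT (p, s)⟩

section Dirac

variable {D : HH →ₗ[ℂ] HH}

lemma dirac_ket2
    (hD : ∀ p s, D (bas p s) = (((p.1.1 : ℝ) / 2 + 1 / 2 : ℝ) : ℂ) • bas p (!s))
    (s : Bool) (L M : ℤ) :
    D (ket2 s L M) = (((L : ℝ) / 2 + 1 / 2 : ℝ) : ℂ) • ket2 (!s) L M := by
  by_cases h : IdxP (L, M)
  · rw [ket2_of_idxP h, ket2_of_idxP h, hD]
  · simp [ket2_eq_zero h]

lemma dirac_symmetric
    (hD : ∀ p s, D (bas p s) = (((p.1.1 : ℝ) / 2 + 1 / 2 : ℝ) : ℂ) • bas p (!s)) :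
    ∀ v ∈ basSpan, ∀ w ∈ basSpan, ⟪D v, w⟫_ℂ = ⟪v, D w⟫_ℂ := by
  intro v hv w hw
  refine Submodule.span_induction₂ (p := fun v w _ _ => ⟪D v, w⟫_ℂ = ⟪v, D w⟫_ℂ)
    ?_ ?_ ?_ ?_ ?_ ?_ ?_ hv hw
  · rintro _ _ ⟨⟨p, s⟩, rfl⟩ ⟨⟨p', s'⟩, rfl⟩
    simp only [hD, inner_smul_left, inner_smul_right, Complex.conj_ofReal]
    by_cases h : p = p' ∧ s' = !s
    · obtain ⟨rfl, rfl⟩ := h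
      simp [norm_bas]
    · rw [inner_bas_of_ne, inner_bas_of_ne, mul_zero, mul_zero]
      · rintro h'
        simp only [Prod.mk.injEq] at h'
        exact h ⟨h'.1, by simp [h'.2]⟩
      · rintro h'
        simp only [Prod.mk.injEq] at h'
        exact h ⟨h'.1, by simp [h'.2]⟩
  · simp
  · simp
  · intro x y z _ _ _ h1 h2
    simp [h1, h2]
  · intro x y z _ _ _ h1 h2
    simp [h1, h2]
  · intro r x y _ _ h
    simp [h]
  · intro r x y _ _ h
    simp [h]

/-- An operator which sends `|l,m⟩_±` to a combination of `|l,m'⟩_±`, `|l+1,m'⟩_±`, `|l-1,m'⟩_±`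
with `m' - m` fixed has bounded commutator with `D`, provided that the off-diagonal coefficients
do not depend on the sign `±` and the diagonal ones do so only up to `O(1/l)`. -/
lemma hasBoundedCommutator_of_apply_bas
    (hD : ∀ p s, D (bas p s) = (((p.1.1 : ℝ) / 2 + 1 / 2 : ℝ) : ℂ) • bas p (!s))
    {x : HH →L[ℂ] HH} (d : ℤ) (α : Bool → ℤ → ℤ → ℂ)
    (β γ : ℤ → ℤ → ℂ)
    (hx : ∀ p s, x (bas p s) = α s p.1.1 p.1.2 • ket2 s p.1.1 (p.1.2 + d)
      + β p.1.1 p.1.2 • ket2 s (p.1.1 + 2) (p.1.2 + d)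
      + γ p.1.1 p.1.2 • ket2 s (p.1.1 - 2) (p.1.2 + d))
    (C : ℝ)
    (hC : ∀ (p : Idx) (s : Bool), ‖(((p.1.1 : ℝ) / 2 + 1 / 2 : ℝ) : ℂ) *
      (α s p.1.1 p.1.2 - α (!s) p.1.1 p.1.2)‖ ≤ C) :
    HasBoundedCommutator basSpan D x where
  map_mem v hv := by
    suffices basSpan ≤ basSpan.comap (x : HH →ₗ[ℂ] HH) from this hv
    refine Submodule.span_le.2 ?_
    rintro _ ⟨⟨p, s⟩, rfl⟩
    change x (bas p s) ∈ basSpan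
    rw [hx]
    exact basSpan.add_mem (basSpan.add_mem (basSpan.smul_mem _ (ket2_mem_basSpan _ _ _))
      (basSpan.smul_mem _ (ket2_mem_basSpan _ _ _))) (basSpan.smul_mem _ (ket2_mem_basSpan _ _ _))
  star_map_mem v hv := by
    suffices basSpan ≤ basSpan.comap (star x : HH →L[ℂ] HH).toLinearMap from this hv
    refine Submodule.span_le.2 ?_
    rintro _ ⟨⟨p, s⟩, rfl⟩
    change (star x) (bas p s) ∈ basSpan
    refine mem_basSpan_of_finite_support ?_
    have hinj : Function.Injective fun i : Idx × Bool => (i.2, i.1.1.1, i.1.1.2) := by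
      rintro ⟨p, s⟩ ⟨p', s'⟩ h
      simp only [Prod.mk.injEq] at h
      exact Prod.ext (Subtype.ext (Prod.ext h.2.1 h.2.2)) h.1
    refine (Set.Finite.preimage hinj.injOn (Set.toFinite
      {(s, p.1.1, p.1.2 - d), (s, p.1.1 - 2, p.1.2 - d), (s, p.1.1 + 2, p.1.2 - d)})).subset ?_
    rintro ⟨p', s'⟩ hne
    by_contra hmem
    simp only [Set.mem_preimage, Set.mem_insert_iff, Set.mem_singleton_iff, Prod.mk.injEq,
      not_or] at hmem
    refine hne ?_
    have h1 : (star x (bas p s)) (p', s') = ⟪bas p' s', star x (bas p s)⟫_ℂ := by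
      simp [bas, lp.inner_single_left]
    rw [h1, ContinuousLinearMap.star_eq_adjoint, ContinuousLinearMap.adjoint_inner_right, hx,
      ← ket2_idx p s]
    simp only [inner_add_left, inner_smul_left]
    rw [inner_ket2_of_ne, inner_ket2_of_ne, inner_ket2_of_ne]
    · simp
    all_goals
      simp only [ne_eq, Prod.mk.injEq]
      rintro ⟨h1, h2, h3⟩
      exact hmem.1 ⟨h1, by lia, by lia⟩
  exists_commutator := by
    have hnx : ∀ p s (w : HH), ‖w‖ ≤ 1 → ‖⟪w, x (bas p s)⟫_ℂ‖ ≤ ‖x‖ := by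
      intro p s w hw
      calc ‖⟪w, x (bas p s)⟫_ℂ‖ ≤ ‖w‖ * ‖x (bas p s)‖ := norm_inner_le_norm _ _
        _ ≤ 1 * (‖x‖ * ‖bas p s‖) := by
            gcongr
            exact x.le_opNorm _
        _ = ‖x‖ := by simp [norm_bas]
    have hself : ∀ (s : Bool) (L M : ℤ), IdxP (L, M) → ⟪ket2 s L M, ket2 s L M⟫_ℂ = 1 := by
      intro s L M h
      rw [ket2_of_idxP h, inner_self_eq_norm_sq_to_K, norm_bas]
      simp
    obtain ⟨T₀, hT₀⟩ := exists_clm_shift 0 d (fun p s => (((p.1.1 : ℝ) / 2 + 1 / 2 : ℝ) : ℂ) *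
      (α s p.1.1 p.1.2 - α (!s) p.1.1 p.1.2)) C (fun p s => by
        rw [norm_smul]
        exact (mul_le_of_le_one_right (norm_nonneg _) (norm_ket2_le _ _ _)).trans (hC p s))
    obtain ⟨T₁, hT₁⟩ := exists_clm_shift 2 d (fun p _ => β p.1.1 p.1.2) ‖x‖ (fun p s => by
      by_cases h : IdxP (p.1.1 + 2, p.1.2 + d)
      · rw [norm_smul]
        refine (mul_le_of_le_one_right (norm_nonneg _) (norm_ket2_le _ _ _)).trans ?_
        have := hnx p s (ket2 s (p.1.1 + 2) (p.1.2 + d)) (norm_ket2_le _ _ _)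
        rw [hx, inner_add_right, inner_add_right, inner_smul_right, inner_smul_right,
          inner_smul_right, hself _ _ _ h, inner_ket2_of_ne (by simp), inner_ket2_of_ne (by
            simp only [ne_eq, Prod.mk.injEq, true_and, and_true]; lia)] at this
        simpa using this
      · simp [ket2_eq_zero h])
    obtain ⟨T₂, hT₂⟩ := exists_clm_shift (-2) d (fun p _ => γ p.1.1 p.1.2) ‖x‖ (fun p s => by
      by_cases h : IdxP (p.1.1 + -2, p.1.2 + d)
      · rw [← sub_eq_add_neg] at h ⊢
        rw [norm_smul]
        refine (mul_le_of_le_one_right (norm_nonneg _) (norm_ket2_le _ _ _)).trans ?_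
        have := hnx p s (ket2 s (p.1.1 - 2) (p.1.2 + d)) (norm_ket2_le _ _ _)
        rw [hx, inner_add_right, inner_add_right, inner_smul_right, inner_smul_right,
          inner_smul_right, hself _ _ _ h, inner_ket2_of_ne (by simp), inner_ket2_of_ne (by
            simp only [ne_eq, Prod.mk.injEq, true_and, and_true]; lia)] at this
        simpa using this
      · simp [ket2_eq_zero h])
    refine ⟨T₀ + T₁ - T₂, fun v hv => ?_⟩
    suffices basSpan ≤ LinearMap.eqLocus (T₀ + T₁ - T₂).toLinearMap
        (D ∘ₗ x.toLinearMap - x.toLinearMap ∘ₗ D) from this hv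
    refine Submodule.span_le.2 ?_
    rintro _ ⟨⟨p, s⟩, rfl⟩
    change T₀ (bas p s) + T₁ (bas p s) - T₂ (bas p s) = D (x (bas p s)) - x (D (bas p s))
    rw [hT₀, hT₁, hT₂, hD, map_smul, hx, hx]
    simp only [map_add, map_smul, dirac_ket2 hD, add_zero, ← sub_eq_add_neg]
    push_cast
    module

end Dirac

section Coefficients

variable {q : ℝ}

lemma inv_sub_self_pos (hq0 : 0 < q) (hq1 : q < 1) : 0 < q⁻¹ - q := by
  have := (one_lt_inv₀ hq0).2 hq1
  linarith

lemma qn_eq (q x : ℝ) : qn q x = (q ^ (-x) - q ^ x) / (q⁻¹ - q) := by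
  rw [qn, ← neg_sub (q ^ (-x)), ← neg_sub q⁻¹, neg_div_neg_eq]

lemma qn_nonneg (hq0 : 0 < q) (hq1 : q < 1) {x : ℝ} (hx : 0 ≤ x) : 0 ≤ qn q x := by
  rw [qn_eq]
  refine div_nonneg (sub_nonneg.2 ?_) (inv_sub_self_pos hq0 hq1).le
  exact Real.rpow_le_rpow_of_exponent_ge hq0 hq1.le (by linarith)

lemma qn_le (hq0 : 0 < q) (hq1 : q < 1) (x : ℝ) : qn q x ≤ (q⁻¹ - q)⁻¹ * q ^ (-x) := by
  have := inv_sub_self_pos hq0 hq1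
  have h := Real.rpow_pos_of_pos hq0 x
  rw [qn_eq, div_eq_inv_mul]
  gcongr
  linarith

lemma rpow_one_sub_le_qn (hq0 : 0 < q) (hq1 : q < 1) {x : ℝ} (hx : 1 ≤ x) :
    q ^ (1 - x) ≤ qn q x := by
  rw [qn_eq, le_div_iff₀ (inv_sub_self_pos hq0 hq1), mul_sub]
  have h1 : q ^ (1 - x) * q⁻¹ = q ^ (-x) := by
    rw [← Real.rpow_neg_one, ← Real.rpow_add hq0]
    ring_nf
  have h2 : q ^ (1 - x) * q = q ^ (2 - x) := by
    rw [← Real.rpow_add_one hq0.ne']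
    ring_nf
  have h3 : q ^ x ≤ q ^ (2 - x) :=
    Real.rpow_le_rpow_of_exponent_ge hq0 hq1.le (by linarith)
  linarith

lemma qn_mul_qn_le (hq0 : 0 < q) (hq1 : q < 1) {x y z : ℝ} (hy : 0 ≤ y)
    (hz : x + y = z) : qn q x * qn q y ≤ (q⁻¹ - q)⁻¹ ^ 2 * q ^ (-z) := by
  have hK := inv_sub_self_pos hq0 hq1
  calc qn q x * qn q y ≤ ((q⁻¹ - q)⁻¹ * q ^ (-x)) * ((q⁻¹ - q)⁻¹ * q ^ (-y)) :=
        mul_le_mul (qn_le hq0 hq1 x) (qn_le hq0 hq1 y) (qn_nonneg hq0 hq1 hy) (by positivity)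
    _ = (q⁻¹ - q)⁻¹ ^ 2 * q ^ (-z) := by
        rw [← hz, neg_add, Real.rpow_add hq0]
        ring

lemma rpow_le_qn_mul_qn (hq0 : 0 < q) (hq1 : q < 1) {l : ℝ} (hl : 1 / 2 ≤ l) :
    q ^ (-(4 * l)) ≤ qn q (2 * l) * qn q (2 * l + 2) := by
  calc q ^ (-(4 * l)) = q ^ (1 - 2 * l) * q ^ (1 - (2 * l + 2)) := by
        rw [← Real.rpow_add hq0]
        ring_nf
    _ ≤ _ := mul_le_mul (rpow_one_sub_le_qn hq0 hq1 (by linarith))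
        (rpow_one_sub_le_qn hq0 hq1 (by linarith)) (by positivity)
        (qn_nonneg hq0 hq1 (by linarith))

lemma abs_sgn (s : Bool) : |sgn s| = 1 := by
  cases s <;> simp [sgn]

lemma abs_aC1_le (hq0 : 0 < q) (hq1 : q < 1) (s : Bool) {l m : ℝ} (hl : 1 / 2 ≤ l)
    (h1 : -l ≤ m) (h2 : m ≤ l) :
    |aC1 q (sgn s) l m| ≤ (1 + q ^ 2) * (q⁻¹ - q)⁻¹ * q ^ (-2 : ℝ) * q ^ (2 * l + 1) := by
  have hK := inv_sub_self_pos hq0 hq1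
  have hden := rpow_le_qn_mul_qn hq0 hq1 hl
  have hden0 : 0 < q ^ (-(4 * l)) := Real.rpow_pos_of_pos hq0 _
  have hml : 0 ≤ l - m := sub_nonneg.2 h2
  have hsqrt : √(qn q (l + m + 1) * qn q (l - m)) ≤ (q⁻¹ - q)⁻¹ * q ^ (-(l + 1 / 2)) := by
    refine Real.sqrt_le_iff.2 ⟨by positivity, ?_⟩
    refine (qn_mul_qn_le hq0 hq1 hml rfl).trans_eq ?_
    rw [mul_pow, ← Real.rpow_mul_natCast hq0.le]
    congr 2
    push_cast
    ring
  rw [aC1, abs_mul, abs_mul, abs_mul, abs_sgn, abs_div,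
    abs_of_pos (Real.rpow_pos_of_pos hq0 _), abs_of_pos (hden0.trans_le hden),
    abs_of_nonneg (Real.sqrt_nonneg _), abs_of_pos (by positivity : 0 < 1 + q ^ 2), one_mul]
  calc (1 + q ^ 2) * (q ^ (m - 1 / 2) / (qn q (2 * l) * qn q (2 * l + 2))) *
        √(qn q (l + m + 1) * qn q (l - m))
      ≤ (1 + q ^ 2) * (q ^ (m - 1 / 2) / q ^ (-(4 * l))) *
        ((q⁻¹ - q)⁻¹ * q ^ (-(l + 1 / 2))) := by gcongr
    _ = (1 + q ^ 2) * (q⁻¹ - q)⁻¹ * q ^ (m - 1 / 2 - -(4 * l) + -(l + 1 / 2)) := by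
        rw [Real.rpow_add hq0, Real.rpow_sub hq0 (m - 1 / 2)]
        ring
    _ ≤ (1 + q ^ 2) * (q⁻¹ - q)⁻¹ * q ^ (-2 + (2 * l + 1)) := by
        gcongr 1
        exact Real.rpow_le_rpow_of_exponent_ge hq0 hq1.le (by linarith)
    _ = _ := by
        rw [Real.rpow_add hq0]
        ring

lemma abs_bC1_le (hq0 : 0 < q) (hq1 : q < 1) (s : Bool) {l m : ℝ} (hl : 1 / 2 ≤ l)
    (h1 : -l ≤ m) (h2 : m ≤ l) :
    |bC1 q (sgn s) l m| ≤ (1 + q ^ 2) * (q⁻¹ - q)⁻¹ ^ 2 * q ^ (-2 : ℝ) * q ^ (2 * l + 1) := by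
  have hK := inv_sub_self_pos hq0 hq1
  have hden := rpow_le_qn_mul_qn hq0 hq1 hl
  have hden0 : 0 < q ^ (-(4 * l)) := Real.rpow_pos_of_pos hq0 _
  have hu := qn_mul_qn_le hq0 hq1 (x := l - m + 1) (y := l + m) (z := 2 * l + 1)
    (by linarith) (by ring)
  have hv := qn_mul_qn_le hq0 hq1 (x := l - m) (y := l + m + 1) (z := 2 * l + 1)
    (by linarith) (by ring)
  have hu0 : 0 ≤ qn q (l - m + 1) * qn q (l + m) :=
    mul_nonneg (qn_nonneg hq0 hq1 (by linarith)) (qn_nonneg hq0 hq1 (by linarith))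
  have hv0 : 0 ≤ qn q (l - m) * qn q (l + m + 1) :=
    mul_nonneg (qn_nonneg hq0 hq1 (by linarith)) (qn_nonneg hq0 hq1 (by linarith))
  rw [bC1, abs_mul, abs_sgn, one_mul, abs_div, abs_of_pos (hden0.trans_le hden)]
  calc |qn q (l - m + 1) * qn q (l + m) - q ^ 2 * (qn q (l - m) * qn q (l + m + 1))| /
        (qn q (2 * l) * qn q (2 * l + 2))
      ≤ (qn q (l - m + 1) * qn q (l + m) + q ^ 2 * (qn q (l - m) * qn q (l + m + 1))) /
        (qn q (2 * l) * qn q (2 * l + 2)) := by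
        have := hden0.trans_le hden
        gcongr
        refine (abs_sub _ _).trans_eq ?_
        rw [abs_of_nonneg hu0, abs_of_nonneg (by positivity)]
    _ ≤ ((q⁻¹ - q)⁻¹ ^ 2 * q ^ (-(2 * l + 1)) + q ^ 2 * ((q⁻¹ - q)⁻¹ ^ 2 * q ^ (-(2 * l + 1)))) /
        q ^ (-(4 * l)) := by gcongr
    _ = (1 + q ^ 2) * (q⁻¹ - q)⁻¹ ^ 2 * q ^ (-(2 * l + 1) - -(4 * l)) := by
        rw [Real.rpow_sub hq0]
        ring
    _ = (1 + q ^ 2) * (q⁻¹ - q)⁻¹ ^ 2 * q ^ (-2 + (2 * l + 1)) := by ring_nf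
    _ = _ := by
        rw [Real.rpow_add hq0]
        ring

lemma mul_rpow_self_le (hq0 : 0 < q) (hq1 : q < 1) (x : ℝ) : x * q ^ x ≤ (-Real.log q)⁻¹ := by
  have ht : 0 < -Real.log q := neg_pos.2 (Real.log_neg hq0 hq1)
  have h := Real.add_one_le_exp (-Real.log q * x)
  have h2 : q ^ x * Real.exp (-Real.log q * x) = 1 := by
    rw [Real.rpow_def_of_pos hq0, ← Real.exp_add]
    simp
  rw [← one_div, le_div_iff₀ ht, ← h2]
  have := Real.rpow_pos_of_pos hq0 x
  nlinarith

lemma Idx.bounds (p : Idx) :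
    1 / 2 ≤ (p.1.1 / 2 : ℝ) ∧ -(p.1.1 / 2 : ℝ) ≤ p.1.2 / 2 ∧ (p.1.2 / 2 : ℝ) ≤ p.1.1 / 2 := by
  obtain ⟨⟨L, M⟩, h0, -, -, h⟩ := p
  obtain ⟨h1, h2⟩ := abs_le.1 h
  have h0' : (1 : ℝ) ≤ L := by exact_mod_cast h0
  have h1' : -(L : ℝ) ≤ M := by exact_mod_cast h1
  have h2' : (M : ℝ) ≤ L := by exact_mod_cast h2
  refine ⟨?_, ?_, ?_⟩ <;> dsimp only <;> linarith

lemma norm_weight_mul_sub_le (hq0 : 0 < q) (hq1 : q < 1) {B l u v : ℝ} (hl : 1 / 2 ≤ l)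
    (hB : 0 ≤ B) (hu : |u| ≤ B * q ^ (2 * l + 1)) (hv : |v| ≤ B * q ^ (2 * l + 1)) :
    ‖((l + 1 / 2 : ℝ) : ℂ) * ((u : ℂ) - (v : ℂ))‖ ≤ B * (-Real.log q)⁻¹ := by
  rw [← Complex.ofReal_sub, ← Complex.ofReal_mul, Complex.norm_real, Real.norm_eq_abs, abs_mul,
    abs_of_nonneg (by linarith)]
  calc (l + 1 / 2) * |u - v| ≤ (l + 1 / 2) * (B * q ^ (2 * l + 1) + B * q ^ (2 * l + 1)) := by
        gcongr
        exact (abs_sub _ _).trans (add_le_add hu hv)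
    _ = B * ((2 * l + 1) * q ^ (2 * l + 1)) := by ring
    _ ≤ _ := by
        gcongr
        exact mul_rpow_self_le hq0 hq1 _

end Coefficients

/-- For every `x ∈ A`, the commutator of the Dirac operator `D` with `x` is
bounded: `x` maps the span of the basis to itself, there is `C ≥ 0` with
`‖Dxv - xDv‖ ≤ C‖v‖` on the span, and `Dx - xD` extends to a bounded operator on `H`. -/
theorem statement9 (q : ℝ) (hq0 : 0 < q) (hq1 : q < 1)
    (πa πb : HH →L[ℂ] HH)
    (hπa : ∀ (p : Idx) (s : Bool), πa (bas p s) = aVal2 q s p.1.1 p.1.2)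
    (hπb : ∀ (p : Idx) (s : Bool), πb (bas p s) = bVal2 q s p.1.1 p.1.2)
    (D : HH →ₗ.[ℂ] HH)
    (hdom : D.domain = Submodule.span ℂ (Set.range fun y : Idx × Bool => bas y.1 y.2))
    (hD : ∀ (p : Idx) (s : Bool) (h : bas p s ∈ D.domain),
      D ⟨bas p s, h⟩ = (((p.1.1 : ℝ) / 2 + 1 / 2 : ℝ) : ℂ) • bas p (!s))
    :
    ∀ x ∈ StarAlgebra.adjoin ℂ ({πa, πb} : Set (HH →L[ℂ] HH)),
      (∀ v ∈ D.domain, x v ∈ D.domain) ∧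
      (∃ C : ℝ, 0 ≤ C ∧ ∀ (v : HH) (hv : v ∈ D.domain) (hxv : x v ∈ D.domain),
        ‖D ⟨x v, hxv⟩ - x (D ⟨v, hv⟩)‖ ≤ C * ‖v‖) ∧
      (∃ T : HH →L[ℂ] HH, ∀ (v : HH) (hv : v ∈ D.domain) (hxv : x v ∈ D.domain),
        T v = D ⟨x v, hxv⟩ - x (D ⟨v, hv⟩)) := by
  change D.domain = basSpan at hdom
  have hbas : ∀ p s, bas p s ∈ D.domain := fun p s => hdom ▸ bas_mem_basSpan p s
  obtain ⟨D', hD'⟩ := LinearMap.exists_extend D.toFun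
  have hDD' : ∀ v (hv : v ∈ D.domain), D ⟨v, hv⟩ = D' v := fun v hv =>
    (LinearMap.congr_fun hD' ⟨v, hv⟩).symm
  have hD'bas : ∀ p s, D' (bas p s) = (((p.1.1 : ℝ) / 2 + 1 / 2 : ℝ) : ℂ) • bas p (!s) :=
    fun p s => by rw [← hDD' _ (hbas p s), hD]
  have hK := inv_sub_self_pos hq0 hq1
  have ha : HasBoundedCommutator basSpan D' πa := by
    refine hasBoundedCommutator_of_apply_bas hD'bas 2
      (fun s L M => ((aC1 q (sgn s) (L / 2 : ℝ) (M / 2 : ℝ) : ℝ) : ℂ))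
      (fun L M => ((aC2 q (L / 2 : ℝ) (M / 2 : ℝ) : ℝ) : ℂ))
      (fun L M => -((aC3 q (L / 2 : ℝ) (M / 2 : ℝ) : ℝ) : ℂ))
      (fun p s => by rw [hπa, aVal2, sub_eq_add_neg, neg_smul])
      ((1 + q ^ 2) * (q⁻¹ - q)⁻¹ * q ^ (-2 : ℝ) * (-Real.log q)⁻¹) (fun p s => ?_)
    obtain ⟨h0, h1, h2⟩ := p.bounds
    exact norm_weight_mul_sub_le hq0 hq1 h0 (by positivity) (abs_aC1_le hq0 hq1 s h0 h1 h2)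
      (abs_aC1_le hq0 hq1 (!s) h0 h1 h2)
  have hb : HasBoundedCommutator basSpan D' πb := by
    refine hasBoundedCommutator_of_apply_bas hD'bas 0
      (fun s L M => ((bC1 q (sgn s) (L / 2 : ℝ) (M / 2 : ℝ) : ℝ) : ℂ))
      (fun L M => -((bC2 q (L / 2 : ℝ) (M / 2 : ℝ) : ℝ) : ℂ))
      (fun L M => -((bC3 q (L / 2 : ℝ) (M / 2 : ℝ) : ℝ) : ℂ))
      (fun p s => by
        rw [hπb, bVal2, sub_eq_add_neg, sub_eq_add_neg, neg_smul, neg_smul, add_zero])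
      ((1 + q ^ 2) * (q⁻¹ - q)⁻¹ ^ 2 * q ^ (-2 : ℝ) * (-Real.log q)⁻¹) (fun p s => ?_)
    obtain ⟨h0, h1, h2⟩ := p.bounds
    exact norm_weight_mul_sub_le hq0 hq1 h0 (by positivity) (abs_bC1_le hq0 hq1 s h0 h1 h2)
      (abs_bC1_le hq0 hq1 (!s) h0 h1 h2)
  intro x hx
  have h : HasBoundedCommutator basSpan D' x :=
    .of_mem_adjoin dense_basSpan (dirac_symmetric hD'bas)
      (by rintro _ (rfl | rfl) <;> assumption) hx
  obtain ⟨T, hT⟩ := h.exists_commutator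
  have hT' : ∀ (v : HH) (hv : v ∈ D.domain) (hxv : x v ∈ D.domain),
      T v = D ⟨x v, hxv⟩ - x (D ⟨v, hv⟩) := fun v hv hxv => by
    rw [hDD', hDD']
    exact hT v (hdom ▸ hv)
  exact ⟨hdom ▸ h.map_mem,
    ⟨‖T‖, norm_nonneg _, fun v hv hxv => hT' v hv hxv ▸ T.le_opNorm v⟩, T, hT'⟩
end
end

section
/- The Dirac operator D commutes with the real structure J and anticommutes with the grading γ on the span of the basis: for every vector v in the span of the basis of H, D J v = J D v and D γ v = −γ D v. -/
noncomputable section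

open scoped ComplexConjugate ENNReal InnerProductSpace

/-- The index map `(l, m) ↦ (l, -m)`. -/
def pFlip (p : Idx) : Idx :=
  ⟨(p.1.1, -p.1.2), p.2.1, p.2.2.1, p.2.2.2.1.neg, by simpa using p.2.2.2.2⟩

/-- A partially defined linear map intertwines two semilinear maps on its whole domain as soon as
it does so on a family spanning the domain. -/
theorem LinearPMap.intertwines_of_span {R E F ι : Type*} [Ring R] {σ : R →+* R}
    [AddCommGroup E] [Module R E] [AddCommGroup F] [Module R F]
    (D : E →ₗ.[R] F) (b : ι → E) (hdom : D.domain = Submodule.span R (Set.range b))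
    (S : E →ₛₗ[σ] E) (T : F →ₛₗ[σ] F)
    (h : ∀ (i : ι) (hi : b i ∈ D.domain),
      ∃ hS : S (b i) ∈ D.domain, D ⟨S (b i), hS⟩ = T (D ⟨b i, hi⟩))
    (v : E) (hv : v ∈ D.domain) :
    ∃ hS : S v ∈ D.domain, D ⟨S v, hS⟩ = T (D ⟨v, hv⟩) := by
  have hspan : v ∈ Submodule.span R (Set.range b) := hdom ▸ hv
  suffices ∃ (hw : v ∈ D.domain) (hS : S v ∈ D.domain), D ⟨S v, hS⟩ = T (D ⟨v, hw⟩) from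
    this.2
  clear hv
  induction hspan using Submodule.span_induction with
  | mem x hx =>
    obtain ⟨i, rfl⟩ := hx
    have hi : b i ∈ D.domain := hdom ▸ Submodule.subset_span ⟨i, rfl⟩
    exact ⟨hi, h i hi⟩
  | zero =>
    refine ⟨D.domain.zero_mem, by simp, ?_⟩
    have h0 : D ⟨0, D.domain.zero_mem⟩ = 0 := D.map_zero
    simp [h0]
  | add x y _ _ hx hy =>
    obtain ⟨hx, hSx, ex⟩ := hx
    obtain ⟨hy, hSy, ey⟩ := hy
    refine ⟨D.domain.add_mem hx hy, by simpa using D.domain.add_mem hSx hSy, ?_⟩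
    have h1 := D.map_add ⟨x, hx⟩ ⟨y, hy⟩
    have h2 := D.map_add ⟨S x, hSx⟩ ⟨S y, hSy⟩
    simp only [AddMemClass.mk_add_mk] at h1 h2
    rw [h1, T.map_add, ← ex, ← ey, ← h2]
    congr 2
    exact S.map_add x y
  | smul c x _ hx =>
    obtain ⟨hx, hSx, ex⟩ := hx
    refine ⟨D.domain.smul_mem c hx, by simpa using D.domain.smul_mem (σ c) hSx, ?_⟩
    have h1 := D.map_smul c ⟨x, hx⟩
    have h2 := D.map_smul (σ c) ⟨S x, hSx⟩
    simp only [SetLike.mk_smul_mk] at h1 h2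
    rw [h1, T.map_smulₛₗ, ← ex, ← h2]
    congr 2
    exact S.map_smulₛₗ c x

theorem sgn_not (s : Bool) : sgn (!s) = -sgn s := by
  cases s <;> simp [sgn]

/-- On the span of the basis, the Dirac operator `D` commutes with the real
structure `J` and anticommutes with the grading `γ`: `DJv = JDv` and `Dγv = -γDv`. -/
theorem statement11 (q : ℝ) (hq0 : 0 < q) (hq1 : q < 1)
    (γ : HH →L[ℂ] HH)
    (hγ : ∀ (p : Idx) (s : Bool), γ (bas p s) = ((sgn s : ℝ) : ℂ) • bas p s)
    (J : HH →SL[starRingEnd ℂ] HH)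
    (hJ : ∀ (p : Idx) (s : Bool), J (bas p s) = (Complex.I ^ p.1.2) • bas (pFlip p) (!s))
    (D : HH →ₗ.[ℂ] HH)
    (hdom : D.domain = Submodule.span ℂ (Set.range fun y : Idx × Bool => bas y.1 y.2))
    (hD : ∀ (p : Idx) (s : Bool) (h : bas p s ∈ D.domain),
      D ⟨bas p s, h⟩ = (((p.1.1 : ℝ) / 2 + 1 / 2 : ℝ) : ℂ) • bas p (!s))
    :
    ∀ (v : HH) (hv : v ∈ D.domain),
      (∃ hJv : J v ∈ D.domain, D ⟨J v, hJv⟩ = J (D ⟨v, hv⟩)) ∧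
      (∃ hγv : γ v ∈ D.domain, D ⟨γ v, hγv⟩ = -(γ (D ⟨v, hv⟩))) := by
  have hb : ∀ p s, bas p s ∈ D.domain := fun p s =>
    hdom ▸ Submodule.subset_span ⟨(p, s), rfl⟩
  have hDsmul : ∀ (c : ℂ) (p : Idx) (s : Bool) (h : c • bas p s ∈ D.domain),
      D ⟨c • bas p s, h⟩ = c • (((p.1.1 : ℝ) / 2 + 1 / 2 : ℝ) : ℂ) • bas p (!s) := by
    intro c p s h
    rw [← hD p s (hb p s), ← D.map_smul]
    rfl
  intro v hv
  constructor
  · refine D.intertwines_of_span _ hdom J.toLinearMap J.toLinearMap ?_ v hv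
    rintro ⟨p, s⟩ hi
    simp only [ContinuousLinearMap.coe_coe, hJ, hD, map_smulₛₗ, Complex.conj_ofReal]
    refine ⟨D.domain.smul_mem _ (hb _ _), ?_⟩
    rw [hDsmul, smul_comm]
    rfl
  · refine D.intertwines_of_span _ hdom γ.toLinearMap (-γ.toLinearMap) ?_ v hv
    rintro ⟨p, s⟩ hi
    simp only [ContinuousLinearMap.coe_coe, LinearMap.neg_apply, hγ, hD, map_smul]
    refine ⟨D.domain.smul_mem _ (hb _ _), ?_⟩
    rw [hDsmul, smul_comm, sgn_not, Complex.ofReal_neg, neg_smul, smul_neg, smul_neg, neg_neg]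
end
end

section
/- The Dirac operator D, defined on the dense span of the basis of H, is essentially self-adjoint; the spectrum of its closure is exactly the set of nonzero integers {n ∈ ℤ : n ≠ 0}, consisting entirely of eigenvalues; for every nonzero integer n, the eigenspace of the closure of D for the eigenvalue n has dimension 2|n| (so |D| has eigenvalues k = 1, 2, 3, … with multiplicity 4k); and the resolvent of the closure of D is compact. -/
noncomputable section

open scoped ComplexConjugate ENNReal InnerProductSpace

/-- The eigenspace of a partially defined operator `T` for the eigenvalue `z`, as a submodule
of the domain of `T`. -/
def eigSp (T : HH →ₗ.[ℂ] HH) (z : ℂ) : Submodule ℂ T.domain :=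
  LinearMap.ker (T.toFun - z • T.domain.subtype)

open Filter Topology

section WeightedComposition

variable {ι : Type*}

/-- Square-summability is preserved by permuting coordinates and multiplying by a bounded weight. -/
theorem memℓp_two_weighted {a : ι → ℂ} {C : ℝ} (ha : ∀ i, ‖a i‖ ≤ C) (σ : ι ≃ ι)
    (w : lp (fun _ : ι => ℂ) 2) : Memℓp (fun i => a i * w (σ i)) 2 := by
  refine memℓp_gen ?_
  have hw : Summable fun i => ‖w (σ i)‖ ^ (2 : ℝ≥0∞).toReal :=
    ((lp.memℓp w).summable (by norm_num)).comp_injective σ.injective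
  refine Summable.of_nonneg_of_le (fun i => by positivity) (fun i => ?_)
    (hw.mul_left (C ^ (2 : ℝ≥0∞).toReal))
  rw [norm_mul, Real.mul_rpow (norm_nonneg _) (norm_nonneg _)]
  gcongr
  exact ha i

theorem lp_two_norm_le_of_forall_norm_le {C : ℝ} (hC : 0 ≤ C) (σ : ι ≃ ι)
    {u w : lp (fun _ : ι => ℂ) 2} (h : ∀ i, ‖u i‖ ≤ C * ‖w (σ i)‖) : ‖u‖ ≤ C * ‖w‖ := by
  have hp : 0 < (2 : ℝ≥0∞).toReal := by norm_num
  have hsum : HasSum (fun i => ‖w (σ i)‖ ^ (2 : ℝ≥0∞).toReal) (‖w‖ ^ (2 : ℝ≥0∞).toReal) :=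
    σ.hasSum_iff.2 (lp.hasSum_norm hp w)
  refine lp.norm_le_of_tsum_le hp (by positivity) ?_
  rw [Real.mul_rpow hC (norm_nonneg _)]
  refine hasSum_le (fun i => ?_) (lp.hasSum_norm hp u) (hsum.mul_left _) |>.trans' ?_
  · rw [← Real.mul_rpow hC (norm_nonneg _)]
    gcongr
    exact h i
  · exact (lp.norm_rpow_eq_tsum hp u).symm.le

/-- The operator `w ↦ (a i * w (σ i))` on `ℓ²` is compact when the weight `a` tends to zero. -/
theorem exists_isCompactOperator_weighted {a : ι → ℂ} (ha : Tendsto a cofinite (𝓝 0))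
    (σ : ι ≃ ι) :
    ∃ T : lp (fun _ : ι => ℂ) 2 →L[ℂ] lp (fun _ : ι => ℂ) 2,
      IsCompactOperator ⇑T ∧ ∀ w i, T w i = a i * w (σ i) := by
  classical
  obtain ⟨C, hC⟩ := ha.norm.bddAbove_range_of_cofinite
  have hC' : ∀ i, ‖a i‖ ≤ C := fun i => hC ⟨i, rfl⟩
  let L : lp (fun _ : ι => ℂ) 2 →ₗ[ℂ] lp (fun _ : ι => ℂ) 2 :=
    { toFun w := ⟨fun i => a i * w (σ i), memℓp_two_weighted hC' σ w⟩
      map_add' v w := by ext i; exact mul_add _ _ _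
      map_smul' c w := by ext i; exact mul_left_comm _ _ _ }
  let T := L.mkContinuous |C| fun w => lp_two_norm_le_of_forall_norm_le (abs_nonneg C) σ fun i => by
    change ‖a i * w (σ i)‖ ≤ _
    rw [norm_mul]
    gcongr
    exact (hC' i).trans (le_abs_self C)
  have hT : ∀ w i, T w i = a i * w (σ i) := fun _ _ => rfl
  let S : Finset ι → lp (fun _ : ι => ℂ) 2 →L[ℂ] lp (fun _ : ι => ℂ) 2 := fun F =>
    ∑ i ∈ F, (lp.singleContinuousLinearMap ℂ (fun _ : ι => ℂ) 2 i).comp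
      ((lp.evalCLM ℂ (fun _ : ι => ℂ) 2 i).comp T)
  have hS : ∀ F w j, S F w j = if j ∈ F then a j * w (σ j) else 0 := fun F w j => by
    have : S F w = ∑ i ∈ F, lp.single 2 i (a i * w (σ i)) := by
      simp only [S, sum_apply]
      rfl
    rw [this, lp.coeFn_sum, Finset.sum_apply]
    simp [Pi.single_apply]
  refine ⟨T, ?_, hT⟩
  refine isCompactOperator_of_tendsto (l := atTop) (F := S) ?_ (Eventually.of_forall fun F => ?_)
  · rw [Metric.tendsto_atTop]
    intro ε hε
    have hfin := (ha.norm.eventually_lt_const (u := ε / 2) (by simpa using half_pos hε))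
    rw [eventually_cofinite] at hfin
    refine ⟨hfin.toFinset, fun F hF => ?_⟩
    rw [dist_eq_norm]
    refine (ContinuousLinearMap.opNorm_le_bound _ (half_pos hε).le fun w => ?_).trans_lt
      (half_lt_self hε)
    refine lp_two_norm_le_of_forall_norm_le (half_pos hε).le σ fun i => ?_
    rw [sub_apply, lp.coeFn_sub, Pi.sub_apply, hS, hT]
    split_ifs with hi
    · simp only [sub_self, norm_zero]
      positivity
    · rw [zero_sub, norm_neg, norm_mul]
      gcongr
      by_contra hlt
      exact hi (hF (hfin.mem_toFinset.2 fun h => hlt h.le))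
  · refine Submodule.sum_mem (compactOperator (RingHom.id ℂ) _ _) fun i _ => ?_
    exact IsCompactOperator.comp_clm (M₂ := ℂ)
      (isCompactOperator_of_locallyCompactSpace_rng
        (lp.singleContinuousLinearMap ℂ (fun _ : ι => ℂ) 2 i))
      ((lp.evalCLM ℂ (fun _ : ι => ℂ) 2 i).comp T)

end WeightedComposition

/-- The integer `l + 1/2`. -/
def level (p : Idx) : ℤ := (p.1.1 + 1) / 2

theorem two_mul_level (p : Idx) : 2 * level p = p.1.1 + 1 := by
  obtain ⟨c, hc⟩ := p.2.2.1
  unfold level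
  omega

theorem level_pos (p : Idx) : 0 < level p := by
  have := two_mul_level p
  have := p.2.1
  omega

theorem level_cast_ne_zero (p : Idx) : (level p : ℂ) ≠ 0 :=
  Int.cast_ne_zero.2 (level_pos p).ne'

theorem half_add_half_eq_level (p : Idx) :
    (((p.1.1 : ℝ) / 2 + 1 / 2 : ℝ) : ℂ) = (level p : ℂ) := by
  have h : (2 : ℂ) * (level p : ℂ) = (p.1.1 : ℂ) + 1 := by exact_mod_cast two_mul_level p
  push_cast
  linear_combination (-1 / 2 : ℂ) * h

theorem finite_setOf_level_le (N : ℤ) : {p : Idx | level p ≤ N}.Finite := by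
  refine (((Set.finite_Icc 0 (2 * N)).prod (Set.finite_Icc (-(2 * N)) (2 * N))).preimage
    Subtype.val_injective.injOn).subset fun p (hp : level p ≤ N) => ?_
  have h := two_mul_level p
  obtain ⟨h1, -, -, h2⟩ := p.2
  rw [abs_le] at h2
  simp only [Set.mem_preimage, Set.mem_prod, Set.mem_Icc]
  omega

theorem tendsto_level_cofinite :
    Tendsto (fun i : Idx × Bool => level i.1) cofinite atTop := by
  refine tendsto_atTop.2 fun N => eventually_cofinite.2 ?_
  refine ((finite_setOf_level_le N).prod Set.finite_univ).subset fun i hi => ?_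
  exact ⟨(not_le.1 hi).le, trivial⟩

theorem tendsto_inv_level_add (z : ℂ) :
    Tendsto (fun i : Idx × Bool => ((level i.1 : ℂ) + z)⁻¹) cofinite (𝓝 0) := by
  refine tendsto_inv₀_cobounded.comp ((tendsto_norm_atTop_iff_cobounded).1 ?_)
  have h : Tendsto (fun i : Idx × Bool => (level i.1 : ℝ) - ‖z‖) cofinite atTop :=
    tendsto_atTop_add_const_right _ _ (tendsto_intCast_atTop_atTop.comp tendsto_level_cofinite)
  refine tendsto_atTop_mono (fun i => ?_) h
  have h1 := norm_sub_le_norm_add (level i.1 : ℂ) z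
  rw [Complex.norm_intCast] at h1
  exact (sub_le_sub_right (le_abs_self _) _).trans h1

theorem card_level_eq (N : ℕ) :
    Nat.card {p : Idx // level p = N} = 2 * N := by
  rw [← Nat.card_fin (2 * N)]
  refine (Nat.card_eq_of_bijective (fun j : Fin (2 * N) =>
    (⟨⟨(2 * N - 1, 2 * j - (2 * N - 1)), ?_⟩, ?_⟩ : {p : Idx // level p = N})) ⟨?_, ?_⟩).symm
  · have := j.2
    refine ⟨by dsimp only; omega, ⟨N - 1, by dsimp only; ring⟩, ⟨j - N, by dsimp only; ring⟩, ?_⟩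
    rw [abs_le]
    dsimp only
    omega
  · unfold level
    dsimp only
    omega
  · intro i j h
    have := congrArg (fun x : {p : Idx // level p = N} => x.1.1.2) h
    dsimp only at this
    ext
    omega
  · rintro ⟨p, hp⟩
    have h1 := two_mul_level p
    obtain ⟨-, -, ⟨c, hc⟩, h2⟩ := p.2
    rw [abs_le] at h2
    refine ⟨⟨(c + N).toNat, by omega⟩, ?_⟩
    ext
    · dsimp only
      omega
    · dsimp only
      omega

/-- The exchange of the two copies of the index set. -/
def flipSign : Idx × Bool ≃ Idx × Bool := (Equiv.refl Idx).prodCongr Equiv.boolNot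

@[simp]
theorem flipSign_apply (p : Idx) (s : Bool) : flipSign (p, s) = (p, !s) := rfl

@[simp]
theorem flipSign_fst (i : Idx × Bool) : (flipSign i).1 = i.1 := rfl

@[simp]
theorem flipSign_flipSign (i : Idx × Bool) : flipSign (flipSign i) = i := by
  ext <;> simp [flipSign]

/-- The graph of the maximal Dirac operator. -/
def diracGraph : Submodule ℂ (HH × HH) where
  carrier := {x | ∀ i, x.2 i = level i.1 * x.1 (flipSign i)}
  add_mem' {x y} hx hy i := by
    simp only [Prod.snd_add, Prod.fst_add, lp.coeFn_add, Pi.add_apply, hx i, hy i, mul_add]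
  zero_mem' i := by simp
  smul_mem' c x hx i := by
    simp only [Prod.smul_snd, Prod.smul_fst, lp.coeFn_smul, Pi.smul_apply, hx i, smul_eq_mul]
    ring

theorem mem_diracGraph {v w : HH} :
    (v, w) ∈ diracGraph ↔ ∀ i, w i = level i.1 * v (flipSign i) := Iff.rfl

theorem isClosed_diracGraph : IsClosed (diracGraph : Set (HH × HH)) := by
  have hc : ∀ i, Continuous fun v : HH => v i :=
    fun i => (lp.evalCLM ℂ (fun _ : Idx × Bool => ℂ) 2 i).continuous
  have : (diracGraph : Set (HH × HH)) = ⋂ i : Idx × Bool,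
      {x : HH × HH | x.2 i = (level i.1 : ℂ) * x.1 (flipSign i)} := by
    ext x
    rw [Set.mem_iInter]
    rfl
  rw [this]
  exact isClosed_iInter fun i => isClosed_eq ((hc i).comp continuous_snd)
    (continuous_const.mul ((hc _).comp continuous_fst))

theorem bas_mem_diracGraph (p : Idx) (s : Bool) :
    (bas p s, (level p : ℂ) • bas p (!s)) ∈ diracGraph := by
  rintro ⟨p', s'⟩
  by_cases hp : p' = p
  · subst hp
    cases s <;> cases s' <;> simp [bas]
  · simp [bas, hp]

theorem adjoint_diracGraph : diracGraph.adjoint = diracGraph := by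
  ext ⟨y, z⟩
  rw [Submodule.mem_adjoint_iff]
  constructor
  · rintro h ⟨p, s⟩
    have := h _ _ (bas_mem_diracGraph p s)
    rw [inner_smul_left, bas, bas, lp.inner_single_left, lp.inner_single_left, sub_eq_zero] at this
    simpa using this.symm
  · intro h a b hab
    rw [sub_eq_zero, lp.inner_eq_tsum, lp.inner_eq_tsum, ← flipSign.tsum_eq]
    refine tsum_congr fun i => ?_
    simp only [mem_diracGraph.1 h, mem_diracGraph.1 hab, flipSign_fst, flipSign_flipSign,
      RCLike.inner_apply, map_mul, map_intCast]
    ring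

theorem bas_mem_domain {D : HH →ₗ.[ℂ] HH}
    (hdom : D.domain = Submodule.span ℂ (Set.range fun y : Idx × Bool => bas y.1 y.2))
    (p : Idx) (s : Bool) : bas p s ∈ D.domain := by
  rw [hdom]
  exact Submodule.subset_span ⟨(p, s), rfl⟩

theorem dense_domain {D : HH →ₗ.[ℂ] HH}
    (hdom : D.domain = Submodule.span ℂ (Set.range fun y : Idx × Bool => bas y.1 y.2)) :
    Dense (D.domain : Set HH) := by
  intro v
  refine mem_closure_of_tendsto (lp.hasSum_single (by norm_num) v)
    (Eventually.of_forall fun F => Submodule.sum_mem _ fun i _ => ?_)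
  have : lp.single 2 i (v i) = v i • bas i.1 i.2 := by
    rw [bas, ← lp.single_smul, smul_eq_mul, mul_one]
  rw [this]
  exact Submodule.smul_mem _ _ (bas_mem_domain hdom _ _)

theorem graph_le_diracGraph {D : HH →ₗ.[ℂ] HH}
    (hdom : D.domain = Submodule.span ℂ (Set.range fun y : Idx × Bool => bas y.1 y.2))
    (hD : ∀ (p : Idx) (s : Bool) (h : bas p s ∈ D.domain),
      D ⟨bas p s, h⟩ = (((p.1.1 : ℝ) / 2 + 1 / 2 : ℝ) : ℂ) • bas p (!s)) :
    D.graph ≤ diracGraph := by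
  have hle : Submodule.span ℂ (Set.range fun y : Idx × Bool => bas y.1 y.2) ≤
      (diracGraph.comap (LinearMap.prod D.domain.subtype D.toFun)).map D.domain.subtype := by
    rw [Submodule.span_le]
    rintro _ ⟨⟨p, s⟩, rfl⟩
    refine ⟨⟨bas p s, bas_mem_domain hdom p s⟩, ?_, rfl⟩
    change (bas p s, D ⟨bas p s, _⟩) ∈ diracGraph
    rw [hD, half_add_half_eq_level]
    exact bas_mem_diracGraph p s
  rintro ⟨v, w⟩ hvw
  obtain ⟨x, rfl, rfl⟩ := D.mem_graph_iff.1 hvw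
  have hx : (x : HH) ∈ Submodule.span ℂ (Set.range fun y : Idx × Bool => bas y.1 y.2) :=
    hdom ▸ x.2
  obtain ⟨x', hx', heq⟩ := hle hx
  rw [← Subtype.ext heq]
  exact hx'

theorem diracGraph_le_topologicalClosure {D : HH →ₗ.[ℂ] HH}
    (hdom : D.domain = Submodule.span ℂ (Set.range fun y : Idx × Bool => bas y.1 y.2))
    (hD : ∀ (p : Idx) (s : Bool) (h : bas p s ∈ D.domain),
      D ⟨bas p s, h⟩ = (((p.1.1 : ℝ) / 2 + 1 / 2 : ℝ) : ℂ) • bas p (!s)) :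
    diracGraph ≤ D.graph.topologicalClosure := by
  rintro ⟨v, w⟩ hvw
  have hv := lp.hasSum_single (by norm_num) v
  have hw := flipSign.hasSum_iff.2 (lp.hasSum_single (by norm_num) w)
  refine mem_closure_of_tendsto (hv.prodMk hw)
    (Eventually.of_forall fun F => Submodule.sum_mem _ fun i _ => ?_)
  have h1 : lp.single 2 i (v i) = v i • bas i.1 i.2 := by
    rw [bas, ← lp.single_smul, smul_eq_mul, mul_one]
  have h2 : lp.single 2 (flipSign i) (w (flipSign i)) =
      v i • (level i.1 : ℂ) • bas i.1 (!i.2) := by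
    rw [mem_diracGraph.1 hvw, bas, ← lp.single_smul, ← lp.single_smul]
    rw [flipSign_flipSign, flipSign_fst, smul_eq_mul, smul_eq_mul, mul_one, mul_comm]
    rfl
  simp only [Function.comp_apply, h1, h2]
  have h3 : (bas i.1 i.2, (level i.1 : ℂ) • bas i.1 (!i.2)) ∈ D.graph :=
    D.mem_graph_iff.2 ⟨⟨_, bas_mem_domain hdom i.1 i.2⟩, rfl, by
      rw [hD, half_add_half_eq_level]⟩
  exact D.graph.smul_mem (v i) h3

theorem graph_closure_eq_diracGraph {D : HH →ₗ.[ℂ] HH}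
    (hdom : D.domain = Submodule.span ℂ (Set.range fun y : Idx × Bool => bas y.1 y.2))
    (hD : ∀ (p : Idx) (s : Bool) (h : bas p s ∈ D.domain),
      D ⟨bas p s, h⟩ = (((p.1.1 : ℝ) / 2 + 1 / 2 : ℝ) : ℂ) • bas p (!s)) :
    D.closure.graph = diracGraph := by
  have hcl : D.graph.topologicalClosure = diracGraph :=
    le_antisymm (D.graph.topologicalClosure_minimal (graph_le_diracGraph hdom hD)
      isClosed_diracGraph) (diracGraph_le_topologicalClosure hdom hD)
  have : D.IsClosable := by
    refine ⟨diracGraph.toLinearPMap, ?_⟩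
    rw [hcl, Submodule.toLinearPMap_graph_eq]
    rintro ⟨v, w⟩ hx (rfl : v = 0)
    ext i
    simpa using mem_diracGraph.1 hx i
  rw [← this.graph_closure_eq_closure_graph, hcl]

theorem apply_coord_of_graph_eq {T : HH →ₗ.[ℂ] HH} (hT : T.graph = diracGraph)
    (v : T.domain) (i : Idx × Bool) :
    T v i = level i.1 * (v : HH) (flipSign i) := by
  have h := T.mem_graph v
  rw [hT] at h
  exact h i

theorem exists_apply_eq_of_graph_eq {T : HH →ₗ.[ℂ] HH} (hT : T.graph = diracGraph)
    {v w : HH}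
    (h : ∀ i, w i = level i.1 * v (flipSign i)) : ∃ hv : v ∈ T.domain, T ⟨v, hv⟩ = w := by
  have hvw : (v, w) ∈ T.graph := hT ▸ mem_diracGraph.2 h
  obtain ⟨⟨x, hx⟩, rfl, hxw⟩ := T.mem_graph_iff.1 hvw
  exact ⟨hx, hxw⟩

theorem isSelfAdjoint_of_graph_eq {T : HH →ₗ.[ℂ] HH} (hT : T.graph = diracGraph)
    (hd : Dense (T.domain : Set HH)) : IsSelfAdjoint T := by
  rw [LinearPMap.isSelfAdjoint_def]
  apply LinearPMap.eq_of_eq_graph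
  rw [LinearPMap.adjoint_graph_eq_graph_adjoint hd, hT, adjoint_diracGraph]

theorem mem_eigSp {T : HH →ₗ.[ℂ] HH} {z : ℂ} {v : T.domain} : v ∈ eigSp T z ↔ T v = z • (v : HH) := by
  rw [eigSp, LinearMap.mem_ker, LinearMap.sub_apply, sub_eq_zero]
  rfl

theorem eigenvector_coord {T : HH →ₗ.[ℂ] HH} (hT : T.graph = diracGraph)
    {z : ℂ} {v : T.domain} (hv : T v = z • (v : HH)) (i : Idx × Bool) :
    z * (v : HH) i = level i.1 * (v : HH) (flipSign i) := by
  rw [← apply_coord_of_graph_eq hT, hv]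
  rfl

theorem eigenvector_coord_sq {T : HH →ₗ.[ℂ] HH} (hT : T.graph = diracGraph)
    {z : ℂ} {v : T.domain} (hv : T v = z • (v : HH)) (i : Idx × Bool) :
    (z ^ 2 - (level i.1 : ℂ) ^ 2) * (v : HH) i = 0 := by
  have h1 := eigenvector_coord hT hv i
  have h2 := eigenvector_coord hT hv (flipSign i)
  rw [flipSign_flipSign, flipSign_fst] at h2
  linear_combination z * h1 + (level i.1 : ℂ) * h2

theorem eigenvector_coord_eq_zero {T : HH →ₗ.[ℂ] HH} (hT : T.graph = diracGraph)
    {n : ℤ} {v : T.domain} (hv : T v = (n : ℂ) • (v : HH))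
    {i : Idx × Bool} (hi : level i.1 ≠ n.natAbs) : (v : HH) i = 0 := by
  refine (mul_eq_zero.1 (eigenvector_coord_sq hT hv i)).resolve_left fun h => hi ?_
  have h' : n ^ 2 = level i.1 ^ 2 := by exact_mod_cast sub_eq_zero.1 h
  rw [Int.natCast_natAbs, (sq_eq_sq_iff_abs_eq_abs _ _).1 h', abs_of_pos (level_pos _)]

theorem exists_eigenvector_of_shell {T : HH →ₗ.[ℂ] HH} (hT : T.graph = diracGraph)
    {n : ℤ} (hn : n ≠ 0)
    (f : {p : Idx // level p = n.natAbs} → ℂ) :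
    ∃ v : T.domain, T v = (n : ℂ) • (v : HH) ∧ ∀ p, (v : HH) (p.1, true) = f p := by
  classical
  let u : Idx × Bool → ℂ := fun i => if h : level i.1 = n.natAbs then
    (if i.2 then 1 else (n : ℂ) / (n.natAbs : ℤ)) * f ⟨i.1, h⟩ else 0
  have hu : Memℓp u 2 := by
    refine (memℓp_zero ?_).of_exponent_ge zero_le
    refine ((finite_setOf_level_le n.natAbs).prod Set.finite_univ).subset fun i hi => ?_
    have h : level i.1 = n.natAbs := by
      by_contra h
      exact hi (dif_neg h)
    exact ⟨h.le, trivial⟩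
  have hcoord : ∀ i, ((n : ℂ) • (⟨u, hu⟩ : HH)) i = level i.1 * (⟨u, hu⟩ : HH) (flipSign i) := by
    rintro ⟨p, s⟩
    change (n : ℂ) * u (p, s) = level p * u (p, !s)
    by_cases h : level p = n.natAbs
    · have hk : ((n.natAbs : ℤ) : ℂ) ≠ 0 := h ▸ level_cast_ne_zero p
      have hsq : (n : ℂ) ^ 2 = ((n.natAbs : ℤ) : ℂ) ^ 2 := by exact_mod_cast (Int.natAbs_sq n).symm
      cases s
      · simp only [u, h, dite_true, Bool.not_false, if_true, Bool.false_eq_true, if_false]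
        field_simp
        linear_combination f ⟨p, h⟩ * hsq
      · simp only [u, h, dite_true, Bool.not_true, if_true, Bool.false_eq_true, if_false]
        field_simp
    · simp only [u, h, dite_false, mul_zero]
  obtain ⟨hv, hTv⟩ := exists_apply_eq_of_graph_eq hT hcoord
  refine ⟨⟨_, hv⟩, hTv, fun p => ?_⟩
  change u (p.1, true) = f p
  simp [u, p.2]

theorem finrank_eigSp {T : HH →ₗ.[ℂ] HH} (hT : T.graph = diracGraph)
    {n : ℤ} (hn : n ≠ 0) :
    Module.finrank ℂ (eigSp T (n : ℂ)) = 2 * n.natAbs := by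
  have : Finite {p : Idx // level p = n.natAbs} :=
    ((finite_setOf_level_le n.natAbs).subset fun _ hp => le_of_eq hp).to_subtype
  have := Fintype.ofFinite {p : Idx // level p = n.natAbs}
  let L : eigSp T (n : ℂ) →ₗ[ℂ] ({p : Idx // level p = n.natAbs} → ℂ) :=
    { toFun v p := (v.1 : HH) (p.1, true)
      map_add' _ _ := rfl
      map_smul' _ _ := rfl }
  have hbij : Function.Bijective L := by
    constructor
    · rw [injective_iff_map_eq_zero]
      intro v hv
      have hev := mem_eigSp.1 v.2
      have htrue : ∀ p, (v.1 : HH) (p, true) = 0 := fun p => by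
        by_cases hp : level p = n.natAbs
        · exact congrFun hv ⟨p, hp⟩
        · exact eigenvector_coord_eq_zero hT hev hp
      ext ⟨p, s⟩
      cases s
      · have h := eigenvector_coord hT hev (p, true)
        rw [htrue, mul_zero] at h
        exact (mul_eq_zero.1 h.symm).resolve_left (level_cast_ne_zero p)
      · exact htrue p
    · intro f
      obtain ⟨v, hv, hvf⟩ := exists_eigenvector_of_shell hT hn f
      exact ⟨⟨v, mem_eigSp.2 hv⟩, funext hvf⟩
  rw [(LinearEquiv.ofBijective L hbij).finrank_eq, Module.finrank_fintype_fun_eq_card,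
    ← Nat.card_eq_fintype_card, card_level_eq]

theorem exists_eigenvector_iff {T : HH →ₗ.[ℂ] HH} (hT : T.graph = diracGraph)
    (z : ℂ) :
    (∃ v : T.domain, (v : HH) ≠ 0 ∧ T v = z • (v : HH)) ↔ ∃ n : ℤ, n ≠ 0 ∧ z = (n : ℂ) := by
  constructor
  · rintro ⟨v, hv0, hv⟩
    obtain ⟨i, hi⟩ : ∃ i, (v : HH) i ≠ 0 := by
      by_contra! h
      exact hv0 (lp.ext (funext h))
    have hz := (mul_eq_zero.1 (eigenvector_coord_sq hT hv i)).resolve_right hi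
    have hk := (level_pos i.1).ne'
    rcases sq_eq_sq_iff_eq_or_eq_neg.1 (sub_eq_zero.1 hz) with h | h
    · exact ⟨level i.1, hk, h⟩
    · exact ⟨-level i.1, neg_ne_zero.2 hk, by simpa using h⟩
  · rintro ⟨n, hn, rfl⟩
    have hpos : 0 < Module.finrank ℂ (eigSp T (n : ℂ)) := by
      rw [finrank_eigSp hT hn]
      have := Int.natAbs_pos.2 hn
      omega
    have := Module.nontrivial_of_finrank_pos hpos
    obtain ⟨v, hv⟩ := exists_ne (0 : eigSp T (n : ℂ))
    exact ⟨v.1, fun h => hv (Subtype.ext (Subtype.ext h)), mem_eigSp.1 v.2⟩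

theorem exists_compact_resolvent {T : HH →ₗ.[ℂ] HH} (hT : T.graph = diracGraph)
    {z : ℂ} (hz : ¬∃ n : ℤ, n ≠ 0 ∧ z = (n : ℂ)) :
    ∃ R : HH →L[ℂ] HH, IsCompactOperator ⇑R ∧
      (∀ w : HH, ∃ h : R w ∈ T.domain, T ⟨R w, h⟩ - z • R w = w) ∧
      (∀ v : T.domain, R (T v - z • (v : HH)) = (v : HH)) := by
  have hm : ∀ p : Idx, (level p : ℂ) + -z ≠ 0 := fun p h =>
    hz ⟨level p, (level_pos p).ne', by linear_combination -h⟩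
  have hp : ∀ p : Idx, (level p : ℂ) + z ≠ 0 := fun p h =>
    hz ⟨-level p, (neg_ne_zero.2 (level_pos p).ne'), by push_cast; linear_combination h⟩
  have hlim : ∀ c : ℂ, Tendsto (fun i : Idx × Bool => (1 / 2 : ℂ) *
      (((level i.1 : ℂ) + -z)⁻¹ + c * ((level i.1 : ℂ) + z)⁻¹)) cofinite (𝓝 0) := fun c => by
    simpa using ((tendsto_inv_level_add (-z)).add
      ((tendsto_inv_level_add z).const_mul c)).const_mul (1 / 2 : ℂ)
  obtain ⟨A, hAc, hA⟩ := exists_isCompactOperator_weighted (hlim (-1)) (Equiv.refl _)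
  obtain ⟨B, hBc, hB⟩ := exists_isCompactOperator_weighted (hlim 1) flipSign
  have hR : ∀ w i, (A + B) w i = (1 / 2 : ℂ) *
      (((level i.1 : ℂ) + -z)⁻¹ * (w (flipSign i) + w i) +
        ((level i.1 : ℂ) + z)⁻¹ * (w (flipSign i) - w i)) := fun w i => by
    rw [add_apply, lp.coeFn_add, Pi.add_apply, hA, hB, Equiv.refl_apply]
    ring
  refine ⟨A + B, hAc.add hBc, fun w => ?_, fun v => ?_⟩
  · have hcoord : ∀ i, (w + z • (A + B) w) i = level i.1 * (A + B) w (flipSign i) := fun i => by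
      rw [lp.coeFn_add, Pi.add_apply, lp.coeFn_smul, Pi.smul_apply, smul_eq_mul, hR, hR,
        flipSign_flipSign, flipSign_fst]
      have := hm i.1
      have := hp i.1
      field_simp
      ring
    obtain ⟨h, hTh⟩ := exists_apply_eq_of_graph_eq hT hcoord
    exact ⟨h, by rw [hTh, add_sub_cancel_right]⟩
  · ext i
    simp only [hR, lp.coeFn_sub, Pi.sub_apply, lp.coeFn_smul, Pi.smul_apply, smul_eq_mul,
      apply_coord_of_graph_eq hT, flipSign_flipSign, flipSign_fst]
    have := hm i.1
    have := hp i.1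
    field_simp
    ring

/-- The Dirac operator `D`, defined on the dense span of the basis of `H`,
is essentially self-adjoint; the spectrum of its closure consists exactly of the nonzero
integers, all of which are eigenvalues; the eigenspace for the eigenvalue `n` has dimension
`2|n|`; and the resolvent of the closure of `D` is compact. -/
theorem statement12 (q : ℝ) (hq0 : 0 < q) (hq1 : q < 1)
    (D : HH →ₗ.[ℂ] HH)
    (hdom : D.domain = Submodule.span ℂ (Set.range fun y : Idx × Bool => bas y.1 y.2))
    (hD : ∀ (p : Idx) (s : Bool) (h : bas p s ∈ D.domain),
      D ⟨bas p s, h⟩ = (((p.1.1 : ℝ) / 2 + 1 / 2 : ℝ) : ℂ) • bas p (!s))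
    :
    Dense ((D.domain : Submodule ℂ HH) : Set HH) ∧
    IsSelfAdjoint D.closure ∧
    (∀ z : ℂ,
      (∃ v : D.closure.domain, (v : HH) ≠ 0 ∧ D.closure v = z • (v : HH)) ↔
        ∃ n : ℤ, n ≠ 0 ∧ z = (n : ℂ)) ∧
    (∀ n : ℤ, n ≠ 0 → Module.finrank ℂ (eigSp D.closure (n : ℂ)) = 2 * n.natAbs) ∧
    (∀ z : ℂ, (¬∃ n : ℤ, n ≠ 0 ∧ z = (n : ℂ)) →
      ∃ R : HH →L[ℂ] HH, IsCompactOperator ⇑R ∧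
        (∀ w : HH, ∃ h : R w ∈ D.closure.domain, D.closure ⟨R w, h⟩ - z • R w = w) ∧
        (∀ v : D.closure.domain, R (D.closure v - z • (v : HH)) = (v : HH))) := by
  have hG := graph_closure_eq_diracGraph hdom hD
  have hdense := dense_domain hdom
  exact ⟨hdense, isSelfAdjoint_of_graph_eq hG (hdense.mono D.le_closure.1),
    exists_eigenvector_iff hG, fun _ hn => finrank_eigSp hG hn,
    fun _ hz => exists_compact_resolvent hG hz⟩
end
end
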